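/- Let ω be a weight on ℝ₊ with ω ∈ B_p(0) and 1 < p < ∞. Then every u ∈ D^{1,p}(ℝ₊,ω) has a finite limit at zero, Tr^0(u) := lim_{t→0⁺} u(t) ∈ ℝ; moreover u(t) = Tr^0(u) + ∫_0^t u'(τ) dτ for every t > 0, and for every t > 0 one has the quantitative estimate |u(t) − Tr^0(u)| ≤ (∫_0^t |u'(τ)|^p ω(τ) dτ)^{1/p} · Ω^0_ω(t). -/

import Mathlib

open MeasureTheory Set Filter Topology
open scoped NNReal ENNReal

noncomputable section

/-- A weight on `ℝ₊ = (0,∞)`: continuous and positive there. -/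
def IsWeight (ω : ℝ → ℝ) : Prop :=
  ContinuousOn ω (Set.Ioi 0) ∧ ∀ t : ℝ, 0 < t → 0 < ω t

/-- Membership of the pair `(u, u')` in the weighted Dirichlet space
`D^{1,p}(ℝ₊, ω)`: `u'` is locally integrable on `(0,∞)`, `u` is locally
absolutely continuous with derivative `u'`, and `∫_0^∞ |u'|^p ω < ∞`. -/
def MemD (p : ℝ) (ω u u' : ℝ → ℝ) : Prop :=
  (∀ a b : ℝ, 0 < a → a < b → IntegrableOn u' (Set.Ioc a b)) ∧
  (∀ a b : ℝ, 0 < a → a < b → u b - u a = ∫ τ in a..b, u' τ) ∧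
  IntegrableOn (fun t => |u' t| ^ p * ω t) (Set.Ioi 0)

/-- `‖u'‖_{L^p(ℝ₊, ω)} = (∫_0^∞ |u'(t)|^p ω(t) dt)^{1/p}`. -/
def dNorm (p : ℝ) (ω u' : ℝ → ℝ) : ℝ :=
  (∫ t in Set.Ioi (0:ℝ), |u' t| ^ p * ω t) ^ (1 / p)

/-- The norm `‖u‖^{(a)} = |u(a)| + ‖u'‖_{L^p(ℝ₊, ω)}`. -/
def aNorm (p : ℝ) (ω : ℝ → ℝ) (a : ℝ) (u u' : ℝ → ℝ) : ℝ :=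
  |u a| + dNorm p ω u'

/-- `ω ∈ B_p(0)`: `∫_0^1 ω(t)^{-1/(p-1)} dt < ∞`. -/
def Bp0 (p : ℝ) (ω : ℝ → ℝ) : Prop :=
  IntegrableOn (fun t => ω t ^ (-1 / (p - 1))) (Set.Ioc (0:ℝ) 1)

/-- `ω ∈ B_p(∞)`: `∫_1^∞ ω(t)^{-1/(p-1)} dt < ∞`. -/
def BpInf (p : ℝ) (ω : ℝ → ℝ) : Prop :=
  IntegrableOn (fun t => ω t ^ (-1 / (p - 1))) (Set.Ioi (1:ℝ))

/-- `Ω^0_ω(t) = (∫_0^t ω(τ)^{-1/(p-1)} dτ)^{1-1/p}`. -/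
def Omega0 (p : ℝ) (ω : ℝ → ℝ) (t : ℝ) : ℝ :=
  (∫ τ in Set.Ioc (0:ℝ) t, ω τ ^ (-1 / (p - 1))) ^ (1 - 1 / p)

/-- `Ω^∞_ω(t) = (∫_t^∞ ω(τ)^{-1/(p-1)} dτ)^{1-1/p}`. -/
def OmegaInf (p : ℝ) (ω : ℝ → ℝ) (t : ℝ) : ℝ :=
  (∫ τ in Set.Ioi t, ω τ ^ (-1 / (p - 1))) ^ (1 - 1 / p)

/-- `R^0_{p,ω}(c)`: elements of `D^{1,p}(ℝ₊,ω)` with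
`u(t) = c + ∫_0^t u'(τ) dτ` for every `t > 0`. -/
def MemR0 (p : ℝ) (ω : ℝ → ℝ) (c : ℝ) (u u' : ℝ → ℝ) : Prop :=
  MemD p ω u u' ∧ ∀ t : ℝ, 0 < t →
    IntegrableOn u' (Set.Ioc 0 t) ∧ u t = c + ∫ τ in Set.Ioc (0:ℝ) t, u' τ

/-- `R^∞_{p,ω}(c)`: elements of `D^{1,p}(ℝ₊,ω)` with
`u(t) = c - ∫_t^∞ u'(τ) dτ` for every `t > 0`. -/
def MemRInf (p : ℝ) (ω : ℝ → ℝ) (c : ℝ) (u u' : ℝ → ℝ) : Prop :=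
  MemD p ω u u' ∧ ∀ t : ℝ, 0 < t →
    IntegrableOn u' (Set.Ioi t) ∧ u t = c - ∫ τ in Set.Ioi t, u' τ

/-- `D_0^{1,p}(ℝ₊,ω)`: elements of `D^{1,p}(ℝ₊,ω)` approximable by smooth
compactly supported functions on `(0,∞)`, with derivatives converging in
`L^p(ℝ₊,ω)` and locally uniform convergence on compact subsets of `(0,∞)`. -/
def MemD0 (p : ℝ) (ω u u' : ℝ → ℝ) : Prop :=
  MemD p ω u u' ∧
  ∃ φ : ℕ → ℝ → ℝ,
    (∀ n, ContDiff ℝ (⊤ : ℕ∞) (φ n) ∧ HasCompactSupport (φ n) ∧ tsupport (φ n) ⊆ Set.Ioi 0) ∧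
    Tendsto (fun n => ∫ t in Set.Ioi (0:ℝ), |deriv (φ n) t - u' t| ^ p * ω t)
      atTop (𝓝 0) ∧
    (∀ K : Set ℝ, K ⊆ Set.Ioi 0 → IsCompact K →
      TendstoUniformlyOn (fun n => φ n) u atTop K)

theorem IsWeight.integrableOn_rpow_Ioc {ω : ℝ → ℝ} {p : ℝ} (hω : IsWeight ω)
    (hB : Bp0 p ω) (t : ℝ) :
    IntegrableOn (fun τ => ω τ ^ (-1 / (p - 1))) (Set.Ioc 0 t) := by
  have hc : ContinuousOn (fun τ => ω τ ^ (-1 / (p - 1))) (Set.Icc 1 t) := fun x hx =>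
    have hx0 : 0 < x := zero_lt_one.trans_le hx.1
    ((hω.1 x hx0).mono fun y hy => zero_lt_one.trans_le hy.1).rpow_const
      (Or.inl (hω.2 x hx0).ne')
  refine (hB.union (hc.integrableOn_compact isCompact_Icc)).mono_set fun x hx => ?_
  rcases le_total x 1 with h | h
  · exact Or.inl ⟨hx.1, h⟩
  · exact Or.inr ⟨h, hx.2⟩

theorem MemD.aestronglyMeasurable {p : ℝ} {ω u u' : ℝ → ℝ} (hu : MemD p ω u u') :
    AEStronglyMeasurable u' (volume.restrict (Set.Ioi 0)) := by
  have hU : Set.Ioi (0 : ℝ) ⊆ ⋃ n : ℕ, Set.Ioc (1 / ((n : ℝ) + 1)) ((n : ℝ) + 2) := by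
    intro x hx
    obtain ⟨n, hn⟩ := exists_nat_one_div_lt (show (0 : ℝ) < x from hx)
    obtain ⟨m, hm⟩ := exists_nat_ge x
    refine Set.mem_iUnion.2 ⟨max n m, ?_, ?_⟩
    · refine lt_of_le_of_lt ?_ hn
      gcongr
      exact le_max_left n m
    · have : (m : ℝ) ≤ ((max n m : ℕ) : ℝ) := by exact_mod_cast le_max_right n m
      linarith
  refine AEStronglyMeasurable.mono_set hU ?_
  refine aestronglyMeasurable_iUnion_iff.2 fun n => (hu.1 _ _ (by positivity) ?_).1
  have : 1 / ((n : ℝ) + 1) ≤ 1 := by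
    rw [div_le_one (by positivity)]
    linarith [(Nat.cast_nonneg n : (0 : ℝ) ≤ n)]
  linarith [(Nat.cast_nonneg n : (0 : ℝ) ≤ n)]

/-- Weighted Hölder inequality for the derivative of an element of `D^{1,p}(ℝ₊, ω)`. -/
theorem MemD.integrableOn_Ioc_and_integral_abs_le {p : ℝ} {ω u u' : ℝ → ℝ} (hp : 1 < p)
    (hω : IsWeight ω) (hB : Bp0 p ω) (hu : MemD p ω u u') (t : ℝ) :
    IntegrableOn u' (Set.Ioc 0 t) ∧
      ∫ τ in Set.Ioc (0 : ℝ) t, |u' τ| ≤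
        (∫ τ in Set.Ioc (0 : ℝ) t, |u' τ| ^ p * ω τ) ^ (1 / p) * Omega0 p ω t := by
  have hp0 : 0 < p := zero_lt_one.trans hp
  have hp1 : 0 < p - 1 := sub_pos.2 hp
  have hpq : p.HolderConjugate p.conjExponent := Real.HolderConjugate.conjExponent hp
  have hq : p.conjExponent = p / (p - 1) := rfl
  have hsub : Set.Ioc (0 : ℝ) t ⊆ Set.Ioi 0 := fun x hx => hx.1
  have hmu : AEStronglyMeasurable u' (volume.restrict (Set.Ioc 0 t)) :=
    hu.aestronglyMeasurable.mono_set hsub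
  have hmω (r : ℝ) : AEStronglyMeasurable (fun τ => ω τ ^ r) (volume.restrict (Set.Ioc 0 t)) :=
    ContinuousOn.aestronglyMeasurable (fun x hx => ((hω.1 x hx.1).mono hsub).rpow_const
      (Or.inl (hω.2 x hx.1).ne')) measurableSet_Ioc
  have hpos : ∀ᵐ τ ∂(volume.restrict (Set.Ioc (0 : ℝ) t)), 0 < ω τ :=
    (ae_restrict_mem measurableSet_Ioc).mono fun τ hτ => hω.2 τ hτ.1
  set f : ℝ → ℝ := fun τ => |u' τ| * ω τ ^ (1 / p) with hf
  set g : ℝ → ℝ := fun τ => ω τ ^ (-1 / p) with hg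
  have hfp : ∀ τ, 0 < ω τ → f τ ^ p = |u' τ| ^ p * ω τ := fun τ h => by
    rw [hf, Real.mul_rpow (abs_nonneg _) (by positivity), ← Real.rpow_mul h.le,
      one_div_mul_cancel hp0.ne', Real.rpow_one]
  have hgq : ∀ τ, 0 < ω τ → g τ ^ p.conjExponent = ω τ ^ (-1 / (p - 1)) := fun τ h => by
    rw [hg, ← Real.rpow_mul h.le, hq]
    congr 1
    field_simp
  have hfg : ∀ τ, 0 < ω τ → f τ * g τ = |u' τ| := fun τ h => by
    rw [hf, hg, mul_assoc, ← Real.rpow_add h, neg_div, add_neg_cancel, Real.rpow_zero, mul_one]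
  have hf0 : 0 ≤ᵐ[volume.restrict (Set.Ioc (0 : ℝ) t)] f := hpos.mono fun τ h => by
    change 0 ≤ |u' τ| * ω τ ^ (1 / p)
    positivity
  have hg0 : 0 ≤ᵐ[volume.restrict (Set.Ioc (0 : ℝ) t)] g := hpos.mono fun τ h => by
    change 0 ≤ ω τ ^ (-1 / p)
    positivity
  have hfL : MemLp f (ENNReal.ofReal p) (volume.restrict (Set.Ioc 0 t)) := by
    have hmf : AEStronglyMeasurable f (volume.restrict (Set.Ioc 0 t)) := hmu.norm.mul (hmω _)
    refine (integrable_norm_rpow_iff hmf (by simpa using hp0)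
      ENNReal.ofReal_ne_top).1 ?_
    rw [ENNReal.toReal_ofReal hp0.le]
    refine (hu.2.2.mono_set hsub).congr ?_
    filter_upwards [hpos, hf0] with τ h h0
    rw [Real.norm_of_nonneg h0, hfp τ h]
  have hgL : MemLp g (ENNReal.ofReal p.conjExponent) (volume.restrict (Set.Ioc 0 t)) := by
    refine (integrable_norm_rpow_iff (hmω _) (by simpa using hpq.symm.pos)
      ENNReal.ofReal_ne_top).1 ?_
    rw [ENNReal.toReal_ofReal hpq.symm.nonneg]
    refine (hω.integrableOn_rpow_Ioc hB t).congr ?_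
    filter_upwards [hpos, hg0] with τ h h0
    rw [Real.norm_of_nonneg h0, hgq τ h]
  have hH := integral_mul_le_Lp_mul_Lq_of_nonneg hpq hf0 hg0 hfL hgL
  have : ENNReal.HolderConjugate (ENNReal.ofReal p) (ENNReal.ofReal p.conjExponent) :=
    hpq.ennrealOfReal
  constructor
  · refine (integrable_norm_iff hmu).1 ((hfL.integrable_mul hgL).congr ?_)
    exact hpos.mono fun τ h => hfg τ h
  · rw [integral_congr_ae (hpos.mono hfg), integral_congr_ae (hpos.mono hfp),
      integral_congr_ae (hpos.mono hgq)] at hH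
    have he : 1 / p.conjExponent = 1 - 1 / p := by
      rw [hq]
      field_simp
    rwa [he] at hH

/-- for `ω ∈ B_p(0)`, every `u ∈ D^{1,p}(ℝ₊,ω)` has a finite
trace `Tr^0(u) = lim_{t→0⁺} u(t)`, with the representation
`u(t) = Tr^0(u) + ∫_0^t u'` and the quantitative estimate
`|u(t) - Tr^0(u)| ≤ (∫_0^t |u'|^p ω)^{1/p} · Ω^0_ω(t)` for all `t > 0`. -/
theorem stmt4 (p : ℝ) (ω : ℝ → ℝ) (hp : 1 < p) (hω : IsWeight ω)
    (hB : Bp0 p ω) (u u' : ℝ → ℝ) (hu : MemD p ω u u') :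
    ∃ c : ℝ, Tendsto u (𝓝[>] 0) (𝓝 c) ∧
      (∀ t : ℝ, 0 < t → IntegrableOn u' (Set.Ioc 0 t) ∧
        u t = c + ∫ τ in Set.Ioc (0:ℝ) t, u' τ) ∧
      (∀ t : ℝ, 0 < t →
        |u t - c| ≤ (∫ τ in Set.Ioc (0:ℝ) t, |u' τ| ^ p * ω τ) ^ (1 / p)
          * Omega0 p ω t) := by
  have hint (t : ℝ) : IntegrableOn u' (Set.Ioc 0 t) :=
    (hu.integrableOn_Ioc_and_integral_abs_le hp hω hB t).1
  have hrep : ∀ t : ℝ, 0 < t →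
      u t = u 1 - (∫ τ in Set.Ioc (0 : ℝ) 1, u' τ) + ∫ τ in Set.Ioc (0 : ℝ) t, u' τ := by
    have hkey : ∀ a b : ℝ, 0 < a → a < b →
        u b - u a = (∫ τ in Set.Ioc (0 : ℝ) b, u' τ) - ∫ τ in Set.Ioc (0 : ℝ) a, u' τ := by
      intro a b ha hab
      have hb := ha.trans hab
      rw [hu.2.1 a b ha hab, ← intervalIntegral.integral_of_le ha.le,
        ← intervalIntegral.integral_of_le hb.le, intervalIntegral.integral_interval_sub_left
          ((intervalIntegrable_iff_integrableOn_Ioc_of_le hb.le).2 (hint b))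
          ((intervalIntegrable_iff_integrableOn_Ioc_of_le ha.le).2 (hint a))]
    intro t ht
    rcases lt_trichotomy t 1 with h | rfl | h
    · linarith [hkey t 1 ht h]
    · ring
    · linarith [hkey 1 t one_pos h]
  refine ⟨u 1 - ∫ τ in Set.Ioc (0 : ℝ) 1, u' τ, ?_, fun t ht => ⟨hint t, hrep t ht⟩, ?_⟩
  · have hc := intervalIntegral.continuousOn_primitive
      ((integrableOn_Icc_iff_integrableOn_Ioc).2 (hint 1))
    have h0 : Tendsto (fun t => ∫ τ in Set.Ioc (0 : ℝ) t, u' τ) (𝓝[>] 0) (𝓝 0) := by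
      have h := (hc 0 (by simp)).mono_left
        ((nhdsWithin_Ioc_eq_nhdsGT (zero_lt_one' ℝ)).symm.le.trans
          (nhdsWithin_mono 0 Set.Ioc_subset_Icc_self))
      simpa using h
    have h1 := h0.const_add (u 1 - ∫ τ in Set.Ioc (0 : ℝ) 1, u' τ)
    rw [add_zero] at h1
    refine h1.congr' ?_
    filter_upwards [self_mem_nhdsWithin] with t ht
    exact (hrep t ht).symm
  · intro t ht
    rw [hrep t ht, add_sub_cancel_left]
    exact abs_integral_le_integral_abs.trans
      (hu.integrableOn_Ioc_and_integral_abs_le hp hω hB t).2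

end
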